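/- arXiv:2112.02961 — 2 statements merged into one kernel-verified Lean document; each statement's English description precedes it below -/
import Mathlib

section
/- For every integer N ≥ 2 and all reals γ > 0, ρ > 0, β > 0, σ > 0, there exists λ₀ > 0 such that for every λ ∈ (0, λ₀) there exist real numbers a, b, c, d, e, f, g, ā, b̄, c̄ satisfying the ten equations (i) 0 = ρa/2 − γ/2 − d·b̄ + (a + λ(N−1)b̄)²/(4λ); (ii) 0 = −ρb/2 + b((N−2)b̄ − c̄) + (d + λ(N−1)((N−2)b̄ − c̄))²/(4λ); (iii) 0 = ρd + b·b̄ − d((N−2)b̄ − c̄) + (a + λ(N−1)b̄)(d + λ(N−1)((N−2)b̄ − c̄))/(2λ); (iv) 0 = −g + σ²c/(2ρ); (v) 0 = −((ρ + 2β)/2)c + f·ā + (e − λ(N−1)ā)²/(4λ); (vi) 0 = −(ρ + β)e + 1 − d·ā + b̄·f − (e − λ(N−1)ā)(a + λ(N−1)b̄)/(2λ); (vii) b·ā + f((N−2)b̄ − c̄) = (ρ + β)f + (e − λ(N−1)ā)(d + λ(N−1)((N−2)b̄ − c̄))/(2λ); (viii) ā = e/((N+1)λ); (ix) b̄ = (−aN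 + a + 2d)/(λ − λN²); (x) c̄ = −(d − aN)/(λ + λN); and moreover ā > 0 and c̄ − (N−1)b̄ > 0. -/
/-- The inventory equations are solvable, after dividing by the price impact and expressing
everything through the feedback coefficients `B` and `C`. -/
lemma exists_inventory_coefficients {n ρ κ : ℝ} (hn : 2 ≤ n) (hρ : 0 < ρ) (hκ : 0 < κ) :
    ∃ B C z : ℝ, 0 ≤ B ∧ 0 < C ∧ n * B ≤ C ∧ 0 ≤ z ∧
      ρ * (2 * C - (n - 1) * B) - 2 * ((n - 1) * (C - n * B)) * B + 2 * C ^ 2 = κ ∧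
      z * (ρ / 2 + (C - (n - 2) * B)) = (n - 1) ^ 2 * B ^ 2 ∧
      (n - 1) * (C - n * B) * (ρ + (C - (n - 2) * B)) + z * B = 2 * (n - 1) * C * B := by
  have hn0 : 0 < n := by linarith
  set P : ℝ → ℝ := fun t => ρ * (2 - (n - 1) * t) with hP
  set Q : ℝ → ℝ := fun t => 2 - 2 * (n - 1) * t * (1 - n * t) with hQ
  set c : ℝ → ℝ := fun t => (-P t + √(P t ^ 2 + 4 * Q t * κ)) / (2 * Q t) with hc
  have bound : ∀ t ∈ Set.Icc (0 : ℝ) (1 / n), n * t ≤ 1 := fun t ht => by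
    have := mul_le_mul_of_nonneg_left ht.2 hn0.le
    rwa [mul_one_div_cancel hn0.ne'] at this
  have hQpos : ∀ t ∈ Set.Icc (0 : ℝ) (1 / n), 0 < Q t := fun t ht => by
    have h1 := bound t ht
    have h0 := ht.1
    have h3 : 0 ≤ n * t := by positivity
    have h2 : t * (1 - n * t) ≤ t := by nlinarith
    have h4 : (n - 1) * (t * (1 - n * t)) ≤ (n - 1) * t :=
      mul_le_mul_of_nonneg_left h2 (by linarith)
    have h5 : (n - 1) * (t * (1 - n * t)) < 1 := by
      rcases h0.eq_or_lt with h | h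
      · simp [← h]
      · linarith
    simp only [hQ]
    linarith
  have hPc : Continuous P := by fun_prop
  have hQc : Continuous Q := by fun_prop
  have hcpos : ∀ t ∈ Set.Icc (0 : ℝ) (1 / n), 0 < c t := fun t ht => by
    have hq := hQpos t ht
    refine div_pos ?_ (by positivity)
    have : P t < √(P t ^ 2 + 4 * Q t * κ) :=
      Real.lt_sqrt_of_sq_lt (by have : 0 < 4 * Q t * κ := by positivity
                                linarith)
    linarith
  have hceq : ∀ t ∈ Set.Icc (0 : ℝ) (1 / n), P t * c t + Q t * c t ^ 2 = κ := fun t ht => by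
    have hq := hQpos t ht
    have hs : √(P t ^ 2 + 4 * Q t * κ) ^ 2 = P t ^ 2 + 4 * Q t * κ :=
      Real.sq_sqrt (by positivity)
    simp only [hc]
    field_simp
    linear_combination hs
  have hcc : ContinuousOn c (Set.Icc 0 (1 / n)) := by
    refine ContinuousOn.div (by fun_prop) (by fun_prop) fun t ht => ?_
    have := hQpos t ht
    positivity
  set F : ℝ → ℝ := fun t =>
    (ρ + (1 - (n - 2) * t) * c t) * (1 - n * t) * (ρ / 2 + (1 - (n - 2) * t) * c t)
      + (n - 1) * t ^ 3 * c t ^ 2 - 2 * t * c t * (ρ / 2 + (1 - (n - 2) * t) * c t) with hF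
  have hFc : ContinuousOn F (Set.Icc 0 (1 / n)) := by fun_prop
  have hinv : 0 ≤ 1 / n := by positivity
  have hF0 : 0 ≤ F 0 := by
    have := hcpos 0 ⟨le_rfl, hinv⟩
    simp only [hF]
    norm_num
    positivity
  have hF1 : F (1 / n) ≤ 0 := by
    have h := hcpos (1 / n) ⟨hinv, le_rfl⟩
    have : F (1 / n) = -(c (1 / n) * ρ / n + (3 * n + 1) / n ^ 3 * c (1 / n) ^ 2) := by
      simp only [hF]
      field_simp
      ring
    rw [this]
    have : 0 ≤ c (1 / n) * ρ / n + (3 * n + 1) / n ^ 3 * c (1 / n) ^ 2 := by positivity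
    linarith
  obtain ⟨t, ht, hFt⟩ := intermediate_value_Icc' hinv hFc ⟨hF1, hF0⟩
  have hC := hcpos t ht
  have hκt := hceq t ht
  have hnt := bound t ht
  have ht0 := ht.1
  simp only [hF] at hFt
  simp only [hP, hQ] at hκt
  set C := c t
  have hk : 0 ≤ 1 - (n - 2) * t := by linarith
  have hd : 0 < ρ / 2 + (C - (n - 2) * (t * C)) := by
    have : 0 ≤ (1 - (n - 2) * t) * C := by positivity
    linarith
  refine ⟨t * C, C, (n - 1) ^ 2 * (t * C) ^ 2 / (ρ / 2 + (C - (n - 2) * (t * C))),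
    by positivity, hC, ?_, by positivity, ?_, div_mul_cancel₀ _ hd.ne', ?_⟩
  · nlinarith
  · linear_combination hκt
  · rw [div_mul_eq_mul_div, ← eq_sub_iff_add_eq', div_eq_iff hd.ne']
    linear_combination (n - 1) * C * hFt

/-- Positivity of the coefficient of `abar` in the signal equation for `e`, once `f` has been
eliminated. -/
lemma signal_coefficient_pos {n ρ β B C z : ℝ} (hn : 2 ≤ n) (hρ : 0 < ρ) (hβ : 0 < β)
    (hB : 0 ≤ B) (hC : 0 < C) (hBC : n * B ≤ C) (hz : 0 ≤ z)
    (hii : z * (ρ / 2 + (C - (n - 2) * B)) = (n - 1) ^ 2 * B ^ 2)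
    (hiii : (n - 1) * (C - n * B) * (ρ + (C - (n - 2) * B)) + z * B = 2 * (n - 1) * C * B) :
    0 < ((ρ + β) * (n + 1) + (n - 1) * (C - n * B) + 2 * C) * (ρ + β + (C - (n - 2) * B))
      - B * (z + 2 * (n - 1) * B) := by
  have hn1 : 0 ≤ n - 1 := by linarith
  have hD : 0 < ρ + β + (C - (n - 2) * B) := by linarith
  have hy : 0 ≤ (n - 1) * (C - n * B) := mul_nonneg hn1 (by linarith)
  have h1 : z * (2 * B) ≤ z * (ρ / 2 + (C - (n - 2) * B)) :=
    mul_le_mul_of_nonneg_left (by linarith) hz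
  have h2 : 0 ≤ (n - 1) * B * (C - (n - 1) * B) := by
    have : 0 ≤ C - (n - 1) * B := by linarith
    positivity
  have h3 : 0 ≤ (n - 1) * B * (C - 2 * B) := by
    have : 0 ≤ C - 2 * B := by nlinarith
    positivity
  have h4 : 0 < (ρ + β) * (n + 1) * (ρ + β + (C - (n - 2) * B)) := by positivity
  have h5 : 0 < 2 * C * (ρ + β + (C - (n - 2) * B)) := by positivity
  have h6 : 0 ≤ (n - 1) * (C - n * B) * β := by positivity
  linarith


/-- Existence, for all sufficiently small price impact `lam`, of a solution
`(a, b, c, d, e, f, g, abar, bbar, cbar)` of the ten algebraic equations characterizing the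
symmetric closed-loop Nash equilibrium, with `abar > 0` and `cbar - (N-1) * bbar > 0`. -/
theorem closed_loop_system_solvable
    (N : ℕ) (hN : 2 ≤ N) (γ ρ β σ : ℝ)
    (hγ : 0 < γ) (hρ : 0 < ρ) (hβ : 0 < β) (hσ : 0 < σ) :
    ∃ lam0 : ℝ, 0 < lam0 ∧ ∀ lam : ℝ, lam ∈ Set.Ioo (0 : ℝ) lam0 →
      ∃ a b c d e f g abar bbar cbar : ℝ,
        (0 = ρ * a / 2 - γ / 2 - d * bbar
            + (a + lam * ((N : ℝ) - 1) * bbar) ^ 2 / (4 * lam)) ∧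
        (0 = -(ρ * b) / 2 + b * (((N : ℝ) - 2) * bbar - cbar)
            + (d + lam * ((N : ℝ) - 1) * (((N : ℝ) - 2) * bbar - cbar)) ^ 2 / (4 * lam)) ∧
        (0 = ρ * d + b * bbar - d * (((N : ℝ) - 2) * bbar - cbar)
            + (a + lam * ((N : ℝ) - 1) * bbar)
              * (d + lam * ((N : ℝ) - 1) * (((N : ℝ) - 2) * bbar - cbar)) / (2 * lam)) ∧
        (0 = -g + σ ^ 2 * c / (2 * ρ)) ∧
        (0 = -((ρ + 2 * β) / 2) * c + f * abar
            + (e - lam * ((N : ℝ) - 1) * abar) ^ 2 / (4 * lam)) ∧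
        (0 = -(ρ + β) * e + 1 - d * abar + bbar * f
            - (e - lam * ((N : ℝ) - 1) * abar) * (a + lam * ((N : ℝ) - 1) * bbar) / (2 * lam)) ∧
        (b * abar + f * (((N : ℝ) - 2) * bbar - cbar)
            = (ρ + β) * f
              + (e - lam * ((N : ℝ) - 1) * abar)
                * (d + lam * ((N : ℝ) - 1) * (((N : ℝ) - 2) * bbar - cbar)) / (2 * lam)) ∧
        (abar = e / (((N : ℝ) + 1) * lam)) ∧
        (bbar = (-(a * (N : ℝ)) + a + 2 * d) / (lam - lam * (N : ℝ) ^ 2)) ∧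
        (cbar = -(d - a * (N : ℝ)) / (lam + lam * (N : ℝ))) ∧
        0 < abar ∧ 0 < cbar - ((N : ℝ) - 1) * bbar := by
  refine ⟨1, one_pos, fun lam hlam => ?_⟩
  have hl : 0 < lam := hlam.1
  have hn : (2 : ℝ) ≤ N := by exact_mod_cast hN
  generalize (N : ℝ) = n at hn ⊢
  obtain ⟨B, C, z, hB, hC, hBC, hz, hi, hii, hiii⟩ :=
    exists_inventory_coefficients hn hρ (div_pos hγ hl)
  have hS := signal_coefficient_pos hn hρ hβ hB hC hBC hz hii hiii
  have hD : 0 < ρ + β + (C - (n - 2) * B) := by linarith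
  set D := ρ + β + (C - (n - 2) * B) with hDdef
  set S := ((ρ + β) * (n + 1) + (n - 1) * (C - n * B) + 2 * C) * D
    - B * (z + 2 * (n - 1) * B) with hSdef
  set A := D / (lam * S) with hAdef
  set φ := (z + 2 * (n - 1) * B) / (lam * S) with hφdef
  have hA : lam * S * A = D := mul_div_cancel₀ _ (by positivity)
  have hφ : φ * D = A * (z + 2 * (n - 1) * B) := by
    rw [hφdef, hAdef]
    ring
  have hvi : lam * (((ρ + β) * (n + 1) + (n - 1) * (C - n * B) + 2 * C) * A - B * φ) = 1 := by
    refine mul_right_cancel₀ hD.ne' ?_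
    linear_combination hA - lam * B * hφ
  have hγl : γ = lam * (ρ * (2 * C - (n - 1) * B) - 2 * ((n - 1) * (C - n * B)) * B
      + 2 * C ^ 2) := by
    rw [hi]
    field_simp
  have hA0 : 0 < A := by positivity
  clear_value S A φ
  have hn1 : n + 1 ≠ 0 := by linarith
  have hn2 : lam - lam * n ^ 2 ≠ 0 := by
    have : 0 < lam * (n ^ 2 - 1) := mul_pos hl (by nlinarith)
    linarith
  have hn3 : lam + lam * n ≠ 0 := by
    have : 0 < lam * (1 + n) := mul_pos hl (by linarith)
    linarith
  have hρβ : ρ + 2 * β ≠ 0 := by positivity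
  have ea : lam * (2 * C - (n - 1) * B) + lam * (n - 1) * B = 2 * lam * C := by ring
  have ed : lam * ((n - 1) * (C - n * B)) + lam * (n - 1) * ((n - 2) * B - C)
      = -(2 * lam * (n - 1) * B) := by ring
  have ee : (n + 1) * lam * A - lam * (n - 1) * A = 2 * lam * A := by ring
  refine ⟨lam * (2 * C - (n - 1) * B), lam * z,
    2 * lam * A * (φ + A) / (ρ + 2 * β), lam * ((n - 1) * (C - n * B)), (n + 1) * lam * A,
    lam * φ, σ ^ 2 * (2 * lam * A * (φ + A) / (ρ + 2 * β)) / (2 * ρ), A, B, C,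
    ?_, ?_, ?_, ?_, ?_, ?_, ?_, ?_, ?_, ?_, hA0, ?_⟩
  · rw [ea, hγl]
    field_simp
    ring
  · rw [ed]
    field_simp
    linear_combination 8 * lam * hii
  · rw [ea, ed]
    field_simp
    linear_combination -lam * hiii
  · ring
  · rw [ee]
    field_simp
    ring
  · rw [ee, ea]
    field_simp
    linear_combination hvi
  · rw [ee, ed]
    field_simp
    linear_combination -hφ
  · field_simp
  · rw [eq_div_iff hn2]
    ring
  · rw [eq_div_iff hn3]
    ring
  · nlinarith
end

section
/- Let N ≥ 2 be an integer and γ > 0, ρ > 0, β > 0, σ > 0 reals. For λ > 0 set R(λ) = √(γ/((N+1)λ) + ρ²/4) − ρ/2, A(λ) = (√(γ/((N+1)λ) + ρ²/4) + ρ/2)/(√(γ/((N+1)λ) + ρ²/4) + ρ/2 + β), and J(λ) = (1 + 2λN·R(λ)²·A(λ)/γ)·(R(λ)A(λ)/γ)·σ²/(ρ(2β+ρ)(β+ρ+R(λ))) − (1/(ρ(2β+ρ)))·(σR(λ)A(λ)/γ)²·(λN + (γ + 2λN·R(λ)²)/((ρ + 2R(λ))(β+ρ+R(λ)))). Then lim_{λ→0⁺}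 (J(λ) − σ²/(2γρ(2β+ρ)))/√λ = −σ²(1+3N)/(4ρ·γ^{3/2}·√(1+N)). -/
open Filter

/-- Open-loop relative trading speed `R(λ)`. -/
noncomputable def Rol (N : ℕ) (γ ρ lam : ℝ) : ℝ :=
  Real.sqrt (γ / (((N : ℝ) + 1) * lam) + ρ ^ 2 / 4) - ρ / 2

/-- Open-loop aim-portfolio multiplier `A(λ)`. -/
noncomputable def Aol (N : ℕ) (γ ρ β lam : ℝ) : ℝ :=
  (Real.sqrt (γ / (((N : ℝ) + 1) * lam) + ρ ^ 2 / 4) + ρ / 2)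
    / (Real.sqrt (γ / (((N : ℝ) + 1) * lam) + ρ ^ 2 / 4) + ρ / 2 + β)

/-- The open-loop equilibrium value `J(λ)`. -/
noncomputable def Jol (N : ℕ) (γ ρ β σ lam : ℝ) : ℝ :=
  (1 + 2 * lam * (N : ℝ) * (Rol N γ ρ lam) ^ 2 * Aol N γ ρ β lam / γ)
      * (Rol N γ ρ lam * Aol N γ ρ β lam / γ)
      * σ ^ 2 / (ρ * (2 * β + ρ) * (β + ρ + Rol N γ ρ lam))
    - (1 / (ρ * (2 * β + ρ))) * (σ * Rol N γ ρ lam * Aol N γ ρ β lam / γ) ^ 2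
      * (lam * (N : ℝ)
          + (γ + 2 * lam * (N : ℝ) * (Rol N γ ρ lam) ^ 2)
            / ((ρ + 2 * Rol N γ ρ lam) * (β + ρ + Rol N γ ρ lam)))

/-- The value `J`, divided by `σ² / (ρ (2β + ρ))`, in terms of `s = √λ` and
`k = √(c + ρ² s² / 4)`, where `c = γ / (N + 1)`. -/
noncomputable def rescaledValue (n γ ρ β c k s : ℝ) : ℝ :=
  (1 + 2 * n * (k - ρ * s / 2) * c / (γ * (k + (β + ρ / 2) * s)))
      * (c / (γ * (k + (β + ρ / 2) * s) ^ 2))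
    - c ^ 2 / (γ ^ 2 * (k + (β + ρ / 2) * s) ^ 2)
      * (n + (γ + 2 * n * (k - ρ * s / 2) ^ 2) / (2 * k * (k + (β + ρ / 2) * s)))

theorem sqrt_speed_eq {n γ ρ s : ℝ} (hn : 0 < n + 1) (hs : 0 < s) :
    Real.sqrt (γ / ((n + 1) * s ^ 2) + ρ ^ 2 / 4)
      = Real.sqrt (γ / (n + 1) + ρ ^ 2 * s ^ 2 / 4) / s := by
  rw [eq_div_iff hs.ne']
  nth_rewrite 2 [← Real.sqrt_sq hs.le]
  rw [← Real.sqrt_mul' _ (sq_nonneg s)]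
  congr 1
  field_simp

theorem Jol_sq_eq (N : ℕ) {γ ρ β σ s : ℝ} (hγ : 0 < γ) (hρ : 0 < ρ) (hβ : 0 < β) (hs : 0 < s) :
    Jol N γ ρ β σ (s ^ 2) = σ ^ 2 / (ρ * (2 * β + ρ))
      * rescaledValue N γ ρ β (γ / (N + 1)) (Real.sqrt (γ / (N + 1) + ρ ^ 2 * s ^ 2 / 4)) s := by
  have hn : (0 : ℝ) < N + 1 := by positivity
  unfold Jol Aol Rol rescaledValue
  rw [sqrt_speed_eq hn hs]
  have hpos : 0 < γ / (N + 1 : ℝ) + ρ ^ 2 * s ^ 2 / 4 := by positivity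
  have hk : 0 < Real.sqrt (γ / (N + 1 : ℝ) + ρ ^ 2 * s ^ 2 / 4) := Real.sqrt_pos.2 hpos
  have hsq := Real.sq_sqrt hpos.le
  generalize Real.sqrt (γ / (N + 1 : ℝ) + ρ ^ 2 * s ^ 2 / 4) = k at hk hsq ⊢
  have hc : γ / (N + 1 : ℝ) = (k - ρ * s / 2) * (k + ρ * s / 2) := by linear_combination -hsq
  rw [hc]
  have hD : 0 < k + (β + ρ / 2) * s := by positivity
  have hA : (k / s + ρ / 2) / (k / s + ρ / 2 + β)
      = (k + ρ * s / 2) / (k + (β + ρ / 2) * s) := by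
    rw [div_eq_div_iff (by positivity) hD.ne']
    field_simp
    ring
  have hR : k / s - ρ / 2 = (k - ρ * s / 2) / s := by field_simp
  have hB : β + ρ + (k - ρ * s / 2) / s = (k + (β + ρ / 2) * s) / s := by field_simp; ring
  have hK : ρ + 2 * ((k - ρ * s / 2) / s) = 2 * k / s := by field_simp; ring
  rw [hA, hR, hB, hK]
  have h2 : 0 < 2 * β + ρ := by positivity
  generalize k + (β + ρ / 2) * s = D at hD ⊢
  generalize 2 * β + ρ = b at h2 ⊢
  generalize k - ρ * s / 2 = r
  generalize k + ρ * s / 2 = u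
  field_simp

theorem hasDerivAt_sqrt_add_sq {c : ℝ} (hc : 0 < c) (ρ : ℝ) :
    HasDerivAt (fun s : ℝ => Real.sqrt (c + ρ ^ 2 * s ^ 2 / 4)) 0 0 := by
  have h : HasDerivAt (fun s : ℝ => c + ρ ^ 2 * s ^ 2 / 4) 0 0 := by
    simpa using ((((hasDerivAt_id (0 : ℝ)).pow 2).const_mul (ρ ^ 2)).div_const 4).const_add c
  simpa using h.sqrt (by simpa using hc.ne')

theorem hasDerivAt_rescaledValue {n γ ρ β q : ℝ} {k : ℝ → ℝ} (hγ : 0 < γ) (hq : 0 < q)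
    (hk : HasDerivAt k 0 0) (hk0 : k 0 = q) :
    HasDerivAt (fun s => rescaledValue n γ ρ β (q ^ 2) (k s) s)
      (-((2 * β + ρ) * (γ + 2 * n * q ^ 2) / (4 * γ ^ 2 * q))) 0 := by
  have hD : HasDerivAt (fun s => k s + (β + ρ / 2) * s) (β + ρ / 2) 0 := by
    simpa using hk.fun_add ((hasDerivAt_id (0 : ℝ)).const_mul (β + ρ / 2))
  have hr : HasDerivAt (fun s => k s - ρ * s / 2) (-(ρ / 2)) 0 := by
    simpa using hk.fun_sub (((hasDerivAt_id (0 : ℝ)).const_mul ρ).div_const 2)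
  have h1 := (((hr.const_mul (2 * n)).mul_const (q ^ 2)).div (hD.const_mul γ)
    (by simp [hk0, hγ.ne', hq.ne'])).const_add 1
  have h2 := (hasDerivAt_const (0 : ℝ) (q ^ 2)).div ((hD.pow 2).const_mul γ)
    (by simp [hk0, hγ.ne', hq.ne'])
  have h3 := (hasDerivAt_const (0 : ℝ) ((q ^ 2) ^ 2)).div ((hD.pow 2).const_mul (γ ^ 2))
    (by simp [hk0, hγ.ne', hq.ne'])
  have h4 := ((((hr.pow 2).const_mul (2 * n)).const_add γ).div ((hk.const_mul 2).mul hD)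
    (by simp [hk0, hq.ne'])).const_add n
  refine ((h1.mul h2).sub (h3.mul h4)).congr_deriv ?_
  simp [hk0]
  field_simp
  ring

theorem rescaledValue_zero {n γ ρ β q : ℝ} (hγ : 0 < γ) (hq : 0 < q) :
    rescaledValue n γ ρ β (q ^ 2) q 0 = 1 / (2 * γ) := by
  unfold rescaledValue
  simp only [mul_zero, zero_div, sub_zero, add_zero]
  field_simp
  ring

theorem tendsto_sqrt_nhdsGT_zero :
    Tendsto Real.sqrt (nhdsWithin 0 (Set.Ioi 0)) (nhdsWithin 0 (Set.Ioi 0)) := by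
  refine tendsto_nhdsWithin_iff.2 ⟨?_, ?_⟩
  · simpa using (Real.continuous_sqrt.tendsto 0).mono_left nhdsWithin_le_nhds
  · filter_upwards [self_mem_nhdsWithin] with x hx using Real.sqrt_pos.2 hx

/-- Small-`λ` expansion of the open-loop equilibrium value:
`(J(λ) − σ²/(2γρ(2β+ρ)))/√λ → −σ²(1+3N)/(4ργ^{3/2}√(1+N))` as `λ → 0⁺`. -/
theorem open_loop_value_asymptotics
    (N : ℕ) (hN : 2 ≤ N) (γ ρ β σ : ℝ) (hγ : 0 < γ) (hρ : 0 < ρ) (hβ : 0 < β) (hσ : 0 < σ) :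
    Tendsto (fun lam : ℝ =>
        (Jol N γ ρ β σ lam - σ ^ 2 / (2 * γ * ρ * (2 * β + ρ))) / Real.sqrt lam)
      (nhdsWithin (0 : ℝ) (Set.Ioi 0))
      (nhds (-(σ ^ 2 * (1 + 3 * (N : ℝ))
        / (4 * ρ * γ ^ ((3 : ℝ) / 2) * Real.sqrt (1 + (N : ℝ)))))) := by
  have hn : (0 : ℝ) < N + 1 := by positivity
  have hc : 0 < γ / (N + 1 : ℝ) := by positivity
  set q := Real.sqrt (γ / (N + 1 : ℝ)) with hq_def
  have hq : 0 < q := Real.sqrt_pos.2 hc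
  have hq2 : q ^ 2 = γ / (N + 1 : ℝ) := Real.sq_sqrt hc.le
  have hk0 : Real.sqrt (γ / (N + 1 : ℝ) + ρ ^ 2 * 0 ^ 2 / 4) = q := by simp [hq_def]
  have hslope := ((hasDerivAt_rescaledValue (n := N) (β := β) (ρ := ρ) hγ hq
    (hasDerivAt_sqrt_add_sq hc ρ) hk0).const_mul (σ ^ 2 / (ρ * (2 * β + ρ)))).tendsto_slope_zero_right
  have hlim := hslope.comp tendsto_sqrt_nhdsGT_zero
  have hval : σ ^ 2 / (ρ * (2 * β + ρ)) *
      -((2 * β + ρ) * (γ + 2 * N * q ^ 2) / (4 * γ ^ 2 * q))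
      = -(σ ^ 2 * (1 + 3 * (N : ℝ)) / (4 * ρ * γ ^ ((3 : ℝ) / 2) * Real.sqrt (1 + (N : ℝ)))) := by
    have hpow : γ ^ ((3 : ℝ) / 2) = γ * Real.sqrt γ := by
      rw [Real.sqrt_eq_rpow, ← Real.rpow_one_add' hγ.le (by norm_num)]
      norm_num
    have hg : 0 < Real.sqrt γ := Real.sqrt_pos.2 hγ
    have hm : 0 < Real.sqrt (1 + (N : ℝ)) := Real.sqrt_pos.2 (by positivity)
    have hqm : q = Real.sqrt γ / Real.sqrt (1 + (N : ℝ)) := by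
      rw [hq_def, Real.sqrt_div hγ.le, add_comm]
    have hg2 := Real.sq_sqrt hγ.le
    have hm2 : Real.sqrt (1 + (N : ℝ)) ^ 2 = 1 + N := Real.sq_sqrt (by positivity)
    rw [hpow, hq2, hqm]
    generalize Real.sqrt (1 + (N : ℝ)) = m at hm hm2 ⊢
    have hN1 : (N : ℝ) = m ^ 2 - 1 := by linarith
    have h2 : 0 < 2 * β + ρ := by positivity
    rw [hN1, sub_add_cancel]
    field_simp
    ring
  rw [hval] at hlim
  refine hlim.congr' ?_
  filter_upwards [self_mem_nhdsWithin] with lam hlam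
  have hs : 0 < Real.sqrt lam := Real.sqrt_pos.2 hlam
  have hJ := Jol_sq_eq N (σ := σ) hγ hρ hβ hs
  rw [Real.sq_sqrt (le_of_lt hlam)] at hJ
  have h0 := rescaledValue_zero (n := N) (ρ := ρ) (β := β) hγ hq
  have h2 : 0 < 2 * β + ρ := by positivity
  simp only [Function.comp_apply, zero_add, smul_eq_mul]
  rw [hk0, h0, hq2, Real.sq_sqrt (le_of_lt hlam), hJ]
  field_simp
end
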